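/- A Gluck twist on a 2-sphere S embedded in S⁴ with trivial normal bundle produces a smooth 4-manifold X that is homotopy equivalent to S⁴ (it is simply connected with the homology of S⁴). -/

import Mathlib

/-!
STATEMENT 12: A Gluck twist on a 2-sphere `S` embedded in `S⁴` with trivial
normal bundle (i.e. with a tubular neighborhood `S² × D²`) produces a manifold
`X` that is simply connected and homotopy equivalent to `S⁴`.

Here `S²` is modelled as the unit sphere of `ℂ × ℝ` (sup norm), so that
rotation by a unit complex number `z` acts on it; `D²` is the unit disk in `ℂ`,
and the regluing map is `(x, z) ↦ (rot_z x, z)` on the boundary `S² × S¹`.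
-/

noncomputable section

/-- The 2-sphere, as the unit sphere of `ℂ × ℝ`. -/
abbrev GSph2 : Type := Metric.sphere (0 : ℂ × ℝ) 1

/-- The 2-disk, as the unit disk in `ℂ`. -/
abbrev GDisk2 : Type := Metric.closedBall (0 : ℂ) 1

/-- The 4-sphere. -/
abbrev GSph4 : Type := Metric.sphere (0 : EuclideanSpace ℝ (Fin 5)) 1

/-- Rotation of the 2-sphere by a unit complex number `z`. -/
def gRot (z : ℂ) (hz : ‖z‖ = 1) (x : GSph2) : GSph2 :=
  ⟨(z * x.val.1, x.val.2), by
    have hx := mem_sphere_zero_iff_norm.mp x.property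
    rw [mem_sphere_zero_iff_norm, Prod.norm_def] at *
    simp only [norm_mul, hz, one_mul]
    exact hx⟩

/-- The complement of the open tubular neighborhood of the embedded sphere. -/
abbrev GluckCompl (j : GSph2 × GDisk2 → GSph4) : Type :=
  {x : GSph4 // x ∉ j '' {p : GSph2 × GDisk2 | ‖(p.2 : ℂ)‖ < 1}}

/-- The Gluck gluing relation on the disjoint union of the complement of the
tube and a new copy of `S² × D²`: on the boundary `S² × S¹` the two pieces are
identified via `(x, z) ↦ (rot_z x, z)`. -/
def gluckRel (j : GSph2 × GDisk2 → GSph4) :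
    (GluckCompl j ⊕ GSph2 × GDisk2) → (GluckCompl j ⊕ GSph2 × GDisk2) → Prop :=
  fun u v =>
    ∃ (x : GSph2) (z : GDisk2) (hz : ‖(z : ℂ)‖ = 1),
      (match u with
        | Sum.inl a => a.val = j (x, z)
        | Sum.inr _ => False) ∧
      (match v with
        | Sum.inl _ => False
        | Sum.inr b => b = (gRot (z : ℂ) hz x, z))

/-- The result of the Gluck twist. -/
def GluckSpace (j : GSph2 × GDisk2 → GSph4) : Type :=
  Quot (gluckRel j)

instance (j : GSph2 × GDisk2 → GSph4) : TopologicalSpace (GluckSpace j) :=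
  instTopologicalSpaceQuot

section General
open Topology Metric Set
open scoped unitInterval

/-- `Y` is obtained from `W` by attaching the unit ball of `E` along `φ`. -/
structure IsCellAttachment {E W Y : Type*} [NormedAddCommGroup E] [TopologicalSpace W]
    [TopologicalSpace Y] (φ : E → W) (w : W → Y) (e : E → Y) : Prop where
  continuousOn_attach : ContinuousOn φ (sphere 0 1)
  isQuotientMap : IsQuotientMap (Sum.elim w fun v : closedBall (0 : E) 1 => e v)
  apply_sphere : ∀ v, ‖v‖ = 1 → e v = w (φ v)
  injective : Function.Injective w
  injOn : InjOn e (ball 0 1)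
  apply_ne : ∀ v x, ‖v‖ < 1 → e v ≠ w x

namespace IsCellAttachment

variable {E W Y : Type*} [NormedAddCommGroup E] [TopologicalSpace W]
    [TopologicalSpace Y] {φ : E → W} {w : W → Y} {e : E → Y}

theorem continuous_inl (h : IsCellAttachment φ w e) : Continuous w :=
  h.isQuotientMap.continuous.comp _root_.continuous_inl

theorem continuousOn_cell (h : IsCellAttachment φ w e) : ContinuousOn e (closedBall 0 1) :=
  continuousOn_iff_continuous_domRestrict.2
    (h.isQuotientMap.continuous.comp _root_.continuous_inr)

theorem exists_cases (h : IsCellAttachment φ w e) (y : Y) :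
    (∃ x, w x = y) ∨ ∃ v, ‖v‖ ≤ 1 ∧ e v = y := by
  obtain ⟨x | v, rfl⟩ := h.isQuotientMap.surjective y
  · exact .inl ⟨x, rfl⟩
  · exact .inr ⟨v, mem_closedBall_zero_iff.1 v.2, rfl⟩

theorem exists_desc (h : IsCellAttachment φ w e) {Z : Type*} (a : W → Z) (b : E → Z)
    (hab : ∀ v, ‖v‖ = 1 → b v = a (φ v)) :
    ∃ f : Y → Z, (∀ x, f (w x) = a x) ∧ ∀ v, ‖v‖ ≤ 1 → f (e v) = b v := by
  have key : (Sum.elim a fun v : closedBall (0 : E) 1 => b v).FactorsThrough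
      (Sum.elim w fun v : closedBall (0 : E) 1 => e v) := by
    have mixed : ∀ x v, ‖v‖ ≤ 1 → e v = w x → b v = a x := fun x v hv hvx => by
      have hv1 : ‖v‖ = 1 := hv.eq_of_not_lt fun hlt => h.apply_ne v x hlt hvx
      rw [hab v hv1, h.injective ((h.apply_sphere v hv1).symm.trans hvx)]
    rintro (x | ⟨u, hu⟩) (y | ⟨v, hv⟩) hxy <;>
      simp only [Sum.elim_inl, Sum.elim_inr] at hxy ⊢ <;>
      (try replace hu := mem_closedBall_zero_iff.1 hu) <;>
      (try replace hv := mem_closedBall_zero_iff.1 hv)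
    · rw [h.injective hxy]
    · exact (mixed x v hv hxy.symm).symm
    · exact mixed y u hu hxy
    · rcases hv.eq_or_lt with hv1 | hv1
      · rw [mixed (φ v) u hu (hxy.trans (h.apply_sphere v hv1)), hab v hv1]
      · rcases hu.eq_or_lt with hu1 | hu1
        · exact absurd (hxy.symm.trans (h.apply_sphere u hu1)) (h.apply_ne v _ hv1)
        · rw [h.injOn (mem_ball_zero_iff.2 hu1) (mem_ball_zero_iff.2 hv1) hxy]
  have hs := Function.surjInv_eq h.isQuotientMap.surjective
  refine ⟨fun y => Sum.elim a (fun v : closedBall (0 : E) 1 => b v)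
    (Function.surjInv h.isQuotientMap.surjective y), fun x => ?_, fun v hv => ?_⟩
  · exact key (a := Function.surjInv _ (w x)) (b := Sum.inl x) (hs _)
  · exact key (a := Function.surjInv _ (e v))
      (b := Sum.inr ⟨v, mem_closedBall_zero_iff.2 hv⟩) (hs _)

theorem exists_continuous_desc (h : IsCellAttachment φ w e) {T Z : Type*} [TopologicalSpace T]
    [LocallyCompactSpace T] [TopologicalSpace Z] (a : T × W → Z) (b : T × E → Z)
    (ha : Continuous a) (hb : ContinuousOn b (univ ×ˢ closedBall 0 1))
    (hab : ∀ t v, ‖v‖ = 1 → b (t, v) = a (t, φ v)) :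
    ∃ f : T × Y → Z, Continuous f ∧ (∀ t x, f (t, w x) = a (t, x)) ∧
      ∀ t v, ‖v‖ ≤ 1 → f (t, e v) = b (t, v) := by
  obtain ⟨f, hfa, hfb⟩ := h.exists_desc (Z := T → Z) (fun x t => a (t, x)) (fun v t => b (t, v))
    fun v hv => funext fun t => hab t v hv
  refine ⟨fun p => f p.2 p.1, ?_, fun t x => congrFun (hfa x) t,
    fun t v hv => congrFun (hfb v hv) t⟩
  refine h.isQuotientMap.continuous_lift_prod_right ?_
  rw [← Homeomorph.prodSumDistrib.symm.comp_continuous_iff', continuous_sum_dom]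
  constructor
  · exact ha.congr fun p => (congrFun (hfa p.2) p.1).symm
  · refine (hb.comp_continuous (continuous_fst.prodMk
      (continuous_subtype_val.comp continuous_snd)) fun p => ⟨mem_univ _, p.2.2⟩).congr
      fun p => (congrFun (hfb p.2 (mem_closedBall_zero_iff.1 p.2.2)) p.1).symm

/-- Radial extension of the characteristic map `e` past the unit sphere along a homotopy `H`
of `W`. -/
def stretch (φ : E → W) (w : W → Y) (e : E → Y) [NormedSpace ℝ E] (H : ℝ × W → W) (v : E) : Y :=
  open Classical in if ‖v‖ ≤ 1 then e v else w (H (‖v‖ - 1, φ (‖v‖⁻¹ • v)))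

variable [NormedSpace ℝ E] {H : ℝ × W → W}

omit [TopologicalSpace W] [TopologicalSpace Y] in
theorem stretch_of_le {v : E} (hv : ‖v‖ ≤ 1) : stretch φ w e H v = e v := if_pos hv

omit [TopologicalSpace W] [TopologicalSpace Y] in
theorem stretch_of_lt {v : E} (hv : 1 < ‖v‖) :
    stretch φ w e H v = w (H (‖v‖ - 1, φ (‖v‖⁻¹ • v))) := if_neg hv.not_ge

theorem stretch_smul (h : IsCellAttachment φ w e) (hH0 : ∀ s x, s ≤ 0 → H (s, x) = x) {v : E}
    (hv : ‖v‖ = 1) {c : ℝ} (hc : 1 ≤ c) : stretch φ w e H (c • v) = w (H (c - 1, φ v)) := by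
  have hn : ‖c • v‖ = c := by rw [norm_smul, hv, mul_one, Real.norm_of_nonneg (by linarith)]
  rcases hc.eq_or_lt with rfl | hc
  · rw [one_smul, stretch_of_le hv.le, sub_self, hH0 _ _ le_rfl, h.apply_sphere v hv]
  · rw [stretch_of_lt (hn.symm ▸ hc), hn, smul_smul, inv_mul_cancel₀ (by linarith), one_smul]

theorem continuous_stretch (h : IsCellAttachment φ w e) (hH : Continuous H)
    (hH0 : ∀ s x, s ≤ 0 → H (s, x) = x) : Continuous (stretch φ w e H) := by
  classical
  refine continuous_if_le continuous_norm continuous_const ?_ ?_ ?_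
  · exact h.continuousOn_cell.mono fun v hv => mem_closedBall_zero_iff.2 hv
  · have h0 : ∀ v ∈ {v : E | 1 ≤ ‖v‖}, ‖v‖ ≠ 0 := fun v hv => (zero_lt_one.trans_le hv).ne'
    refine h.continuous_inl.comp_continuousOn (hH.comp_continuousOn (.prodMk (by fun_prop) ?_))
    refine h.continuousOn_attach.comp ((continuousOn_id.norm.inv₀ h0).smul continuousOn_id) ?_
    intro v hv
    simpa [norm_smul] using inv_mul_cancel₀ (h0 v hv)
  · intro v hv
    rw [hv, sub_self, hH0 _ _ le_rfl, inv_one, one_smul, h.apply_sphere v hv]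

theorem homotopic_id_of_apply_stretch {x₀ : W} (h : IsCellAttachment φ w e) (hH : Continuous H)
    (hH0 : ∀ s x, s ≤ 0 → H (s, x) = x) (hH1 : ∀ s x, 1 ≤ s → H (s, x) = x₀) (f : C(Y, Y))
    (hfw : ∀ x, f (w x) = w x₀)
    (hfe : ∀ v, ‖v‖ ≤ 1 → f (e v) = stretch φ w e H ((4 : ℝ) • v)) :
    f.Homotopic (.id Y) := by
  obtain ⟨K, hK, hKw, hKe⟩ := h.exists_continuous_desc (T := I)
    (fun p => w (H (3 * p.1, p.2))) (fun p => stretch φ w e H ((1 + 3 * (p.1 : ℝ)) • p.2))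
    (h.continuous_inl.comp (by fun_prop))
    ((h.continuous_stretch hH hH0).comp (by fun_prop)).continuousOn
    fun t v hv => by
      have := t.2.1
      rw [h.stretch_smul hH0 hv (by linarith), add_sub_cancel_left]
  refine ContinuousMap.Homotopic.symm ⟨⟨⟨K, hK⟩, fun y => ?_, fun y => ?_⟩⟩
  · rcases h.exists_cases y with ⟨x, rfl⟩ | ⟨v, hv, rfl⟩
    · simp [hKw, hH0]
    · simp [hKe, hv, stretch_of_le]
  · rcases h.exists_cases y with ⟨x, rfl⟩ | ⟨v, hv, rfl⟩
    · simp [hKw, hfw, hH1]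
    · simp only [hKe _ v hv, hfe v hv]
      norm_num

end IsCellAttachment

theorem exists_contraction (W : Type*) [TopologicalSpace W] [ContractibleSpace W] :
    ∃ (x₀ : W) (H : ℝ × W → W), Continuous H ∧ (∀ s x, s ≤ 0 → H (s, x) = x) ∧
      ∀ s x, 1 ≤ s → H (s, x) = x₀ := by
  obtain ⟨x₀, ⟨H⟩⟩ := id_nullhomotopic W
  refine ⟨x₀, fun p => H (projIcc 0 1 zero_le_one p.1, p.2), ?_, fun s x hs => ?_,
    fun s x hs => ?_⟩
  · exact H.continuous.comp ((continuous_projIcc.comp continuous_fst).prodMk continuous_snd)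
  · dsimp only; rw [projIcc_of_le_left _ hs]; exact H.apply_zero x
  · dsimp only; rw [projIcc_of_right_le _ hs]; exact H.apply_one x

theorem ContractibleSpace.of_leftInverse {X W : Type*} [TopologicalSpace X] [TopologicalSpace W]
    [ContractibleSpace X] (i : C(W, X)) (r : C(X, W)) (hr : Function.LeftInverse r i) :
    ContractibleSpace W := by
  rw [contractible_iff_id_nullhomotopic]
  have := ((id_nullhomotopic X).comp_right r).comp_left i
  rwa [show (r.comp (.id X)).comp i = .id W from ContinuousMap.ext hr] at this

namespace IsCellAttachment

variable {E W Y W' Y' : Type*} [NormedAddCommGroup E] [NormedSpace ℝ E] [TopologicalSpace W]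
  [TopologicalSpace Y] [TopologicalSpace W'] [TopologicalSpace Y'] {φ : E → W} {w : W → Y}
  {e : E → Y} {φ' : E → W'} {w' : W' → Y'} {e' : E → Y'}

theorem exists_map {H' : ℝ × W' → W'} {x₀ : W'} (h : IsCellAttachment φ w e)
    (h' : IsCellAttachment φ' w' e') (hH : Continuous H') (hH0 : ∀ s x, s ≤ 0 → H' (s, x) = x)
    (hH1 : ∀ s x, 1 ≤ s → H' (s, x) = x₀) :
    ∃ f : C(Y, Y'), (∀ x, f (w x) = w' x₀) ∧
      ∀ v, ‖v‖ ≤ 1 → f (e v) = stretch φ' w' e' H' ((2 : ℝ) • v) := by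
  obtain ⟨f, hf, hfw, hfe⟩ := h.exists_continuous_desc (T := Unit) (fun _ => w' x₀)
    (fun p => stretch φ' w' e' H' ((2 : ℝ) • p.2)) continuous_const
    ((h'.continuous_stretch hH hH0).comp (by fun_prop)).continuousOn
    fun t v hv => by
      rw [h'.stretch_smul hH0 hv one_le_two, hH1 _ _ (by norm_num)]
  exact ⟨⟨fun y => f ((), y), by fun_prop⟩, hfw (), hfe ()⟩

omit [TopologicalSpace W'] in
theorem comp_homotopic_id {H : ℝ × W → W} {x₀ : W} {H' : ℝ × W' → W'} {x₀' : W'}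
    (h : IsCellAttachment φ w e) (hH : Continuous H) (hH0 : ∀ s x, s ≤ 0 → H (s, x) = x)
    (hH1 : ∀ s x, 1 ≤ s → H (s, x) = x₀) (f : C(Y, Y')) (g : C(Y', Y))
    (hfw : ∀ x, f (w x) = w' x₀')
    (hfe : ∀ v, ‖v‖ ≤ 1 → f (e v) = stretch φ' w' e' H' ((2 : ℝ) • v))
    (hgw : ∀ x, g (w' x) = w x₀)
    (hge : ∀ v, ‖v‖ ≤ 1 → g (e' v) = stretch φ w e H ((2 : ℝ) • v)) :
    (g.comp f).Homotopic (.id Y) := by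
  refine h.homotopic_id_of_apply_stretch hH hH0 hH1 _ (fun x => ?_) fun v hv => ?_
  · rw [ContinuousMap.comp_apply, hfw, hgw]
  · rw [ContinuousMap.comp_apply, hfe v hv]
    rcases le_or_gt ‖(2 : ℝ) • v‖ 1 with h2 | h2
    · rw [stretch_of_le h2, hge _ h2, smul_smul]
      norm_num
    · rw [stretch_of_lt h2, hgw]
      have h4 : 2 < ‖(4 : ℝ) • v‖ := by
        rw [norm_smul, Real.norm_of_nonneg (by norm_num)] at h2 ⊢
        linarith
      rw [stretch_of_lt (by linarith), hH1 _ _ (by linarith)]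

/-- Attaching a ball to a contractible space gives a homotopy type depending only on the ball. -/
theorem nonempty_homotopyEquiv [ContractibleSpace W] [ContractibleSpace W']
    (h : IsCellAttachment φ w e) (h' : IsCellAttachment φ' w' e') :
    Nonempty (ContinuousMap.HomotopyEquiv Y Y') := by
  obtain ⟨x₀, H, hH, hH0, hH1⟩ := exists_contraction W
  obtain ⟨x₀', H', hH', hH0', hH1'⟩ := exists_contraction W'
  obtain ⟨f, hfw, hfe⟩ := h.exists_map h' hH' hH0' hH1'
  obtain ⟨g, hgw, hge⟩ := h'.exists_map h hH hH0 hH1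
  exact ⟨⟨f, g, h.comp_homotopic_id hH hH0 hH1 f g hfw hfe hgw hge,
    h'.comp_homotopic_id hH' hH0' hH1' g f hgw hge hfw hfe⟩⟩

/-- If the complement of the centre of the attached ball is contractible, so is `W`. -/
theorem contractibleSpace [T1Space Y] (h : IsCellAttachment φ w e)
    [ContractibleSpace ({e 0}ᶜ : Set Y)] : ContractibleSpace W := by
  obtain ⟨r, hrw, hre⟩ := h.exists_desc id (fun v => φ (‖v‖⁻¹ • v))
    fun v hv => by rw [hv, inv_one, one_smul, id]
  have h0 : ‖(0 : E)‖ < 1 := by simp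
  have hr : ContinuousOn r {e 0}ᶜ := by
    have hopen : IsOpen ({e 0}ᶜ : Set Y) := isOpen_compl_singleton
    rw [h.isQuotientMap.continuousOn_isOpen_iff hopen]
    have hpre := hopen.preimage h.isQuotientMap.continuous
    rw [hpre.continuousOn_iff]
    rintro (x | v) hv
    · rw [← IsOpenEmbedding.inl.continuousAt_iff]
      exact (continuous_id.congr fun x => (hrw x).symm).continuousAt
    · rw [← IsOpenEmbedding.inr.continuousAt_iff]
      have hv0 : ‖(v : E)‖ ≠ 0 := fun hv0 => hv (by simp [norm_eq_zero.1 hv0])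
      have hc : ContinuousOn (fun u : closedBall (0 : E) 1 => φ (‖(u : E)‖⁻¹ • (u : E)))
          {u | ‖(u : E)‖ ≠ 0} := by
        refine h.continuousOn_attach.comp
          (ContinuousOn.smul (ContinuousOn.inv₀ (by fun_prop) fun u hu => hu) (by fun_prop)) ?_
        intro u hu
        rw [mem_sphere_zero_iff_norm, norm_smul, norm_inv, norm_norm, inv_mul_cancel₀ hu]
      refine (hc.continuousAt (IsOpen.mem_nhds ?_ hv0)).congr (.of_forall fun u => ?_)
      · exact isOpen_ne_fun (by fun_prop) continuous_const
      · exact (hre u (mem_closedBall_zero_iff.1 u.2)).symm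
  exact ContractibleSpace.of_leftInverse
    ⟨fun x => (⟨w x, fun hx => h.apply_ne 0 x h0 hx.symm⟩ : ({e 0}ᶜ : Set Y)),
      h.continuous_inl.subtype_mk _⟩
    ⟨fun y => r y, continuousOn_iff_continuous_domRestrict.1 hr⟩ hrw

end IsCellAttachment
end General

section Spheres
open Topology Metric Set Module
open scoped unitInterval

theorem contractibleSpace_sphere_compl_singleton {E : Type*} [NormedAddCommGroup E]
    [InnerProductSpace ℝ E] (p : sphere (0 : E) 1) :
    ContractibleSpace ({p}ᶜ : Set (sphere (0 : E) 1)) := by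
  have hp : ‖(p : E)‖ = 1 := mem_sphere_zero_iff_norm.1 p.2
  have := (isOpenEmbedding_stereographic_symm hp).isEmbedding.toHomeomorph
  rw [range_stereographic_symm hp p.2] at this
  exact this.symm.contractibleSpace

/-- A path in a sphere of dimension at least two can be deformed off some point. -/
theorem exists_homotopic_path_notMem_range {E : Type*} [NormedAddCommGroup E]
    [InnerProductSpace ℝ E] [FiniteDimensional ℝ E] (hE : 2 < finrank ℝ E)
    {x y : sphere (0 : E) 1} (γ : Path x y) :
    ∃ (δ : Path x y) (q : sphere (0 : E) 1), γ.Homotopic δ ∧ q ∉ range δ := by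
  let f : C(I, E) := ⟨fun t => γ t, by fun_prop⟩
  obtain ⟨n, hn⟩ := ((Metric.tendsto_nhds.1 (bernsteinApproximation_uniform f))
    (1/4) (by norm_num)).exists
  let p : ℝ → E := fun t => ∑ k : Fin (n + 1),
    (bernsteinPolynomial ℝ n k).eval t • f (bernstein.z k)
  have hp : ∀ t : I, ‖p t - γ t‖ < 1/4 := fun t => by
    have h := (ContinuousMap.dist_apply_le_dist t).trans_lt hn
    rw [dist_eq_norm, bernsteinApproximation.apply] at h
    exact h
  have hp_smooth : ContDiff ℝ 1 p := by
    refine ContDiff.sum fun k _ => ContDiff.smul ?_ contDiff_const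
    simpa using Polynomial.contDiff_aeval (𝕜 := ℝ) (bernsteinPolynomial ℝ n k) 1
  let g : ℝ → E := fun t => p t + (1 - t) • (x - p 0) + t • (y - p 1)
  have hg_smooth : ContDiff ℝ 1 g := by fun_prop
  have hg0 : g 0 = x := by simp [g]
  have hg1 : g 1 = y := by simp [g]
  have hg : ∀ t : I, ‖g t - γ t‖ < 1/2 := fun t => by
    have h0 : ‖(x : E) - p 0‖ < 1/4 := by simpa [norm_sub_rev] using hp 0
    have h1 : ‖(y : E) - p 1‖ < 1/4 := by simpa [norm_sub_rev] using hp 1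
    have ht0 := t.2.1
    have ht1 := t.2.2
    have e : g t - γ t = (p t - γ t) + (1 - (t : ℝ)) • (x - p 0) + (t : ℝ) • (y - p 1) := by
      simp only [g]; abel
    rw [e]
    refine (norm_add₃_le).trans_lt ?_
    rw [norm_smul, norm_smul, Real.norm_of_nonneg ht0, Real.norm_of_nonneg (sub_nonneg.2 ht1)]
    nlinarith [hp t]
  have hne : ∀ s t : I, (1 - (s : ℝ)) • (γ t : E) + (s : ℝ) • g t ≠ 0 := fun s t h => by
    have hγ : ‖(γ t : E)‖ = 1 := mem_sphere_zero_iff_norm.1 (γ t).2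
    have e : (γ t : E) = -((s : ℝ) • (g t - γ t)) := by
      refine sub_eq_zero.1 (Eq.trans ?_ h); module
    have : ‖(γ t : E)‖ < 1 := by
      rw [e, norm_neg, norm_smul, Real.norm_of_nonneg s.2.1]
      nlinarith [hg t, s.2.1, s.2.2, norm_nonneg (g t - γ t)]
    linarith
  let N : I × I → sphere (0 : E) 1 := fun z =>
    ⟨‖(1 - (z.1 : ℝ)) • (γ z.2 : E) + (z.1 : ℝ) • g z.2‖⁻¹ •
      ((1 - (z.1 : ℝ)) • (γ z.2 : E) + (z.1 : ℝ) • g z.2), by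
      rw [mem_sphere_zero_iff_norm, norm_smul, norm_inv, norm_norm,
        inv_mul_cancel₀ (norm_ne_zero_iff.2 (hne _ _))]⟩
  have hN : Continuous N := by
    have hgc := hg_smooth.continuous
    have hc : Continuous fun z : I × I =>
      (1 - (z.1 : ℝ)) • (γ z.2 : E) + (z.1 : ℝ) • g z.2 := by fun_prop
    exact (Continuous.smul (hc.norm.inv₀ fun z => norm_ne_zero_iff.2 (hne _ _)) hc).subtype_mk _
  have hNe : ∀ (z : I × I) (v : sphere (0 : E) 1),
      (1 - (z.1 : ℝ)) • (γ z.2 : E) + (z.1 : ℝ) • g z.2 = v → N z = v := fun z v h =>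
    Subtype.ext <| by
      simp only [N, h]
      rw [mem_sphere_zero_iff_norm.1 v.2, inv_one, one_smul]
  let δ : Path x y :=
    { toFun := fun t => N (1, t)
      continuous_toFun := by fun_prop
      source' := hNe _ _ (by simp [hg0])
      target' := hNe _ _ (by simp [hg1]) }
  obtain ⟨u, hu⟩ : ∃ u : E, u ∉ range (fun z : ℝ × ℝ => z.1 • g z.2) :=
    (ContDiff.dense_compl_range_of_finrank_lt_finrank (by fun_prop) (by simpa using hE)).nonempty
  have hu0 : u ≠ 0 := fun h => hu ⟨(0, 0), by simp [h]⟩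
  refine ⟨δ, ⟨‖u‖⁻¹ • u, by simp [norm_smul, hu0]⟩, ⟨⟨⟨⟨N, hN⟩, fun t => ?_, fun t => rfl⟩, ?_⟩⟩, ?_⟩
  · exact hNe _ _ (by simp)
  · rintro s t (rfl | rfl)
    · exact hNe _ _ (by simp [hg0, ← add_smul])
    · exact hNe _ _ (by simp [hg1, ← add_smul])
  · rintro ⟨t, ht⟩
    have h : ‖g t‖⁻¹ • g t = ‖u‖⁻¹ • u := by simpa [δ, N] using congrArg Subtype.val ht
    refine hu ⟨(‖u‖ * ‖g t‖⁻¹, t), ?_⟩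
    dsimp only
    rw [mul_smul, h, smul_inv_smul₀ (norm_ne_zero_iff.2 hu0)]

theorem simplyConnectedSpace_sphere {E : Type*} [NormedAddCommGroup E]
    [InnerProductSpace ℝ E] [FiniteDimensional ℝ E] (hE : 2 < finrank ℝ E) :
    SimplyConnectedSpace (sphere (0 : E) 1) := by
  rw [simply_connected_iff_loops_nullhomotopic]
  have hrank : 1 < Module.rank ℝ E := by
    rw [← finrank_eq_rank]; exact_mod_cast (one_lt_two.trans hE)
  refine ⟨isPathConnected_iff_pathConnectedSpace.1 (isPathConnected_sphere hrank 0 zero_le_one),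
    fun x γ => ?_⟩
  obtain ⟨δ, q, hγδ, hq⟩ := exists_homotopic_path_notMem_range hE γ
  refine hγδ.trans ?_
  have := contractibleSpace_sphere_compl_singleton q
  have hmem : ∀ t, δ t ∈ ({q}ᶜ : Set (sphere (0 : E) 1)) := fun t h => hq ⟨t, h⟩
  have hx : x ∈ ({q}ᶜ : Set (sphere (0 : E) 1)) := by simpa using hmem 0
  let δ' : Path (⟨x, hx⟩ : ({q}ᶜ : Set (sphere (0 : E) 1))) ⟨x, hx⟩ :=
    { toFun := fun t => ⟨δ t, hmem t⟩
      continuous_toFun := by fun_prop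
      source' := by simp
      target' := by simp }
  exact (SimplyConnectedSpace.paths_homotopic δ' (.refl _)).map
    (⟨Subtype.val, continuous_subtype_val⟩ : C(({q}ᶜ : Set (sphere (0 : E) 1)), _))

end Spheres

section Gluck
open Topology Metric Set

/-- The south pole of the 2-sphere, a fixed point of every rotation. -/
def gSouth : GSph2 := ⟨(0, -1), by simp [Prod.norm_def]⟩

/-- Radial projection onto the 2-sphere. -/
def gNormalize (p : ℂ × ℝ) : GSph2 :=
  open Classical in if hp : p ≠ 0 then ⟨‖p‖⁻¹ • p, by simp [norm_smul, hp]⟩ else gSouth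

theorem gNormalize_val {p : ℂ × ℝ} (hp : p ≠ 0) : (gNormalize p : ℂ × ℝ) = ‖p‖⁻¹ • p := by
  rw [gNormalize, dif_pos hp]

theorem gNormalize_smul (x : GSph2) {r : ℝ} (hr : 0 < r) :
    gNormalize (r • (x : ℂ × ℝ)) = x := by
  have hx : ‖(x : ℂ × ℝ)‖ = 1 := mem_sphere_zero_iff_norm.1 x.2
  have hx0 : (x : ℂ × ℝ) ≠ 0 := norm_ne_zero_iff.1 (by rw [hx]; exact one_ne_zero)
  refine Subtype.ext ?_
  rw [gNormalize_val (smul_ne_zero hr.ne' hx0), norm_smul, hx, Real.norm_of_nonneg hr.le,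
    mul_one, inv_smul_smul₀ hr.ne']

theorem smul_gNormalize {p : ℂ × ℝ} (hp : p ≠ 0) : ‖p‖ • (gNormalize p : ℂ × ℝ) = p := by
  rw [gNormalize_val hp, smul_inv_smul₀ (norm_ne_zero_iff.2 hp)]

theorem continuousOn_gNormalize : ContinuousOn gNormalize {p | p ≠ 0} := by
  rw [IsInducing.subtypeVal.continuousOn_iff]
  refine ContinuousOn.congr ?_ fun p hp => gNormalize_val hp
  exact (continuousOn_id.norm.inv₀ fun p hp => norm_ne_zero_iff.2 hp).smul continuousOn_id

theorem gRot_gNormalize {z : ℂ} (hz : ‖z‖ = 1) {p : ℂ × ℝ} (hp : p ≠ 0) :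
    gRot z hz (gNormalize p) = gNormalize (z * p.1, p.2) := by
  have hn : ‖((z * p.1, p.2) : ℂ × ℝ)‖ = ‖p‖ := by simp [Prod.norm_def, hz]
  have hp' : ((z * p.1, p.2) : ℂ × ℝ) ≠ 0 := norm_ne_zero_iff.1 (by rwa [hn, norm_ne_zero_iff])
  refine Subtype.ext ?_
  rw [gNormalize_val hp', hn]
  simp only [gRot, gNormalize_val hp]
  ext1
  · simp only [Prod.smul_fst, mul_smul_comm]
  · rfl

theorem gRot_gSouth {z : ℂ} (hz : ‖z‖ = 1) : gRot z hz gSouth = gSouth :=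
  Subtype.ext (by simp [gRot, gSouth])

/-- The radial retraction of the plane onto the 2-disk. -/
def gCap (b : ℂ) : GDisk2 :=
  ⟨(max 1 ‖b‖)⁻¹ • b, by
    have h : 0 < max 1 ‖b‖ := lt_max_of_lt_left one_pos
    rw [mem_closedBall_zero_iff, norm_smul, norm_inv, Real.norm_of_nonneg h.le,
      inv_mul_le_one₀ h]
    exact le_max_right _ _⟩

theorem gCap_val {b : ℂ} (hb : ‖b‖ ≤ 1) : (gCap b : ℂ) = b := by
  simp [gCap, hb]

theorem gCap_coe (b : GDisk2) : gCap b = b :=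
  Subtype.ext (gCap_val (mem_closedBall_zero_iff.1 b.2))

theorem continuous_gCap : Continuous gCap := by
  have h : Continuous fun b : ℂ => max 1 ‖b‖ := by fun_prop
  exact ((h.inv₀ fun b => (lt_max_of_lt_left one_pos).ne').smul continuous_id).subtype_mk _

/-- A map from the unit disk to `ℂ × ℝ` whose normalization wraps the disk around the 2-sphere,
collapsing the unit circle to the south pole; the horizontal component is multiplied by `c`. -/
def gPolar (c a : ℂ) : ℂ × ℝ := (c * (a * (1 - ‖a‖ : ℝ)), 1 - 2 * ‖a‖)

theorem continuous_gPolar : Continuous fun q : ℂ × ℂ => gPolar q.1 q.2 := by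
  unfold gPolar
  fun_prop

theorem gPolar_of_norm_eq_one (c : ℂ) {a : ℂ} (ha : ‖a‖ = 1) : gPolar c a = gSouth := by
  simp only [gPolar, gSouth, ha]
  norm_num

theorem gPolar_ne_zero {c a : ℂ} (h : c ≠ 0 ∨ ‖a‖ = 1) : gPolar c a ≠ 0 := by
  intro h0
  have h1 := congrArg Prod.fst h0
  have h2 : 1 - 2 * ‖a‖ = 0 := congrArg Prod.snd h0
  simp only [gPolar, Prod.fst_zero, mul_eq_zero, Complex.ofReal_eq_zero] at h1
  rcases h with hc | ha
  · rcases h1 with h1 | h1 | h1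
    · exact hc h1
    · simp [h1] at h2
    · linarith
  · linarith

theorem gNormalize_gPolar_of_norm_eq_one (c : ℂ) {a : ℂ} (ha : ‖a‖ = 1) :
    gNormalize (gPolar c a) = gSouth := by
  simpa [gPolar_of_norm_eq_one c ha] using gNormalize_smul gSouth one_pos

theorem gRot_gNormalize_gPolar {z c : ℂ} (hz : ‖z‖ = 1) (hc : c ≠ 0) (a : ℂ) :
    gRot z hz (gNormalize (gPolar c a)) = gNormalize (gPolar (z * c) a) := by
  rw [gRot_gNormalize hz (gPolar_ne_zero (.inl hc))]
  simp only [gPolar, mul_assoc]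

/-- The wrapping of the unit disk around the 2-sphere. -/
def gWrap (a : ℂ) : GSph2 := gNormalize (gPolar 1 a)

theorem continuous_gWrap : Continuous gWrap :=
  continuousOn_gNormalize.comp_continuous
    (continuous_gPolar.comp (continuous_const.prodMk continuous_id))
    fun _ => gPolar_ne_zero (.inl one_ne_zero)

theorem gWrap_of_norm_eq_one {a : ℂ} (ha : ‖a‖ = 1) : gWrap a = gSouth :=
  gNormalize_gPolar_of_norm_eq_one 1 ha

theorem exists_pos_of_gWrap_eq {a b : ℂ} (h : gWrap a = gWrap b) :
    ∃ r : ℝ, 0 < r ∧ a * (1 - ‖a‖ : ℝ) = r * (b * (1 - ‖b‖ : ℝ)) ∧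
      1 - 2 * ‖a‖ = r * (1 - 2 * ‖b‖) := by
  have ha := gPolar_ne_zero (a := a) (.inl one_ne_zero)
  have hb := gPolar_ne_zero (a := b) (.inl one_ne_zero)
  have key : gPolar 1 a = (‖gPolar 1 a‖ * ‖gPolar 1 b‖⁻¹) • gPolar 1 b := by
    rw [mul_smul, ← gNormalize_val hb]
    exact (smul_gNormalize ha).symm.trans (by rw [← gWrap, h, gWrap])
  refine ⟨_, mul_pos (norm_pos_iff.2 ha) (inv_pos.2 (norm_pos_iff.2 hb)), ?_,
    congrArg Prod.snd key⟩
  have := congrArg Prod.fst key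
  simpa only [gPolar, one_mul, Prod.smul_fst, Complex.real_smul] using this

theorem gWrap_injOn : InjOn gWrap (ball 0 1) := by
  intro a ha b hb h
  rw [mem_ball_zero_iff] at ha hb
  obtain ⟨r, hr, h1, h2⟩ := exists_pos_of_gWrap_eq h
  have h3 : ‖a‖ * (1 - ‖a‖) = r * (‖b‖ * (1 - ‖b‖)) := by
    have := congrArg norm h1
    rwa [norm_mul, norm_mul, norm_mul, Complex.norm_of_nonneg (by linarith),
      Complex.norm_of_nonneg hr.le, Complex.norm_of_nonneg (by linarith)] at this
  have h4 : r * ((‖a‖ - ‖b‖) * ((1 - ‖a‖) * (1 - ‖b‖) + ‖a‖ * ‖b‖)) = 0 := by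
    linear_combination (1 - 2 * ‖a‖) * h3 - (‖a‖ * (1 - ‖a‖)) * h2
  have h5 : 0 < (1 - ‖a‖) * (1 - ‖b‖) + ‖a‖ * ‖b‖ :=
    add_pos_of_pos_of_nonneg (mul_pos (by linarith) (by linarith)) (by positivity)
  have hab : ‖a‖ = ‖b‖ := by
    simpa [hr.ne', h5.ne', sub_eq_zero] using h4
  have hr1 : r = 1 := by
    rw [hab] at h2 h3
    nlinarith
  rw [hr1, Complex.ofReal_one, one_mul, hab] at h1
  have hb1 : ((1 - ‖b‖ : ℝ) : ℂ) ≠ 0 := Complex.ofReal_ne_zero.2 (by linarith)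
  exact mul_right_cancel₀ hb1 h1

theorem gWrap_ne_gSouth {a : ℂ} (ha : ‖a‖ < 1) : gWrap a ≠ gSouth := by
  intro h
  rw [← gWrap_of_norm_eq_one (norm_one (α := ℂ))] at h
  obtain ⟨r, hr, h1, h2⟩ := exists_pos_of_gWrap_eq h
  have ha1 : ((1 - ‖a‖ : ℝ) : ℂ) ≠ 0 := Complex.ofReal_ne_zero.2 (by linarith)
  have ha0 : a = 0 := by simpa [ha1, -Complex.ofReal_sub] using h1
  simp only [ha0, norm_zero, norm_one] at h2
  linarith

theorem exists_gWrap_eq (x : GSph2) : ∃ a : ℂ, ‖a‖ ≤ 1 ∧ gWrap a = x := by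
  obtain ⟨⟨z, t⟩, hx⟩ := x
  have hx1 : max ‖z‖ |t| = 1 := by simpa [Prod.norm_def] using hx
  have of_smul : ∀ (a : ℂ) (r : ℝ), 0 < r → gPolar 1 a = r • (z, t) → gWrap a = ⟨(z, t), hx⟩ :=
    fun a r hr h => by rw [gWrap, h]; exact gNormalize_smul ⟨(z, t), hx⟩ hr
  rcases eq_or_ne z 0 with rfl | hz
  · have ht : |t| = 1 := by simpa using hx1
    rcases eq_or_eq_neg_of_abs_eq ht with rfl | rfl
    · exact ⟨0, by simp, of_smul 0 1 one_pos (by simp [gPolar])⟩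
    · exact ⟨1, by simp, of_smul 1 1 one_pos (by simp [gPolar]; norm_num)⟩
  · have hz' : 0 < ‖z‖ := norm_pos_iff.2 hz
    obtain ⟨m, ⟨hm0, hm1⟩, hm⟩ : ∃ m ∈ Icc (0 : ℝ) 1, m * (1 - m) * t - ‖z‖ * (1 - 2 * m) = 0 := by
      refine intermediate_value_Icc (f := fun m : ℝ => m * (1 - m) * t - ‖z‖ * (1 - 2 * m))
        zero_le_one (by fun_prop) ⟨?_, ?_⟩ <;> norm_num
    have hm0' : 0 < m := hm0.lt_of_ne (by rintro rfl; norm_num at hm; exact hz hm)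
    have hm1' : m < 1 := hm1.lt_of_ne (by rintro rfl; norm_num at hm; exact hz hm)
    have hn : ‖((m / ‖z‖ : ℝ) : ℂ) * z‖ = m := by
      rw [norm_mul, Complex.norm_of_nonneg (by positivity), div_mul_cancel₀ _ hz'.ne']
    refine ⟨((m / ‖z‖ : ℝ) : ℂ) * z, hn.trans_le hm1, of_smul _ (m * (1 - m) / ‖z‖)
      (div_pos (mul_pos hm0' (by linarith)) hz') ?_⟩
    simp only [gPolar, hn]
    refine Prod.ext ?_ ?_
    · simp only [Prod.smul_mk, Complex.real_smul, Complex.ofReal_div, Complex.ofReal_mul]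
      ring
    · simp only [Prod.smul_mk, smul_eq_mul]
      field_simp
      linarith

/-- The complement in the 4-sphere of the open 4-ball `(S² ∖ south pole) × int D²`. -/
abbrev GluckCore (j : GSph2 × GDisk2 → GSph4) : Type :=
  {x : GSph4 // x ∉ j '' {p : GSph2 × GDisk2 | p.1 ≠ gSouth ∧ ‖(p.2 : ℂ)‖ < 1}}

/-- The common 4-cell: a parametrization of `S² × D²` by the unit ball of `ℂ × ℂ`. -/
def gCell (v : ℂ × ℂ) : GSph2 × GDisk2 := (gWrap v.1, gCap v.2)

theorem continuous_gCell : Continuous gCell :=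
  (continuous_gWrap.comp continuous_fst).prodMk (continuous_gCap.comp continuous_snd)

theorem gCell_injOn : InjOn gCell (ball 0 1) := by
  rintro ⟨a, b⟩ hu ⟨a', b'⟩ hv h
  simp only [mem_ball_zero_iff, Prod.norm_def, max_lt_iff] at hu hv
  have hb := congrArg (fun p : GSph2 × GDisk2 => (p.2 : ℂ)) h
  simp only [gCell, gCap_val hu.2.le, gCap_val hv.2.le] at hb
  exact Prod.ext (gWrap_injOn (mem_ball_zero_iff.2 hu.1) (mem_ball_zero_iff.2 hv.1)
    (congrArg Prod.fst h)) hb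

theorem exists_gCell_eq (p : GSph2 × GDisk2) : ∃ v, ‖v‖ ≤ 1 ∧ gCell v = p := by
  obtain ⟨a, ha, hax⟩ := exists_gWrap_eq p.1
  exact ⟨(a, p.2), max_le ha (mem_closedBall_zero_iff.1 p.2.2),
    Prod.ext hax (gCap_coe p.2)⟩

theorem gCell_mem {v : ℂ × ℂ} (hv : ‖v‖ < 1) :
    gCell v ∈ {p : GSph2 × GDisk2 | p.1 ≠ gSouth ∧ ‖(p.2 : ℂ)‖ < 1} := by
  simp only [Prod.norm_def, max_lt_iff] at hv
  exact ⟨gWrap_ne_gSouth hv.1, by simpa only [gCell, gCap_val hv.2.le] using hv.2⟩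

theorem norm_eq_one_cases {v : ℂ × ℂ} (hv : ‖v‖ = 1) :
    ‖v.1‖ ≤ 1 ∧ ‖v.2‖ ≤ 1 ∧ (‖v.1‖ = 1 ∨ ‖v.2‖ = 1) := by
  rw [Prod.norm_def] at hv
  refine ⟨hv ▸ le_max_left _ _, hv ▸ le_max_right _ _, ?_⟩
  rcases max_choice ‖v.1‖ ‖v.2‖ with h | h
  · exact .inl (h ▸ hv)
  · exact .inr (h ▸ hv)

/-- The gluing map of the 4-cell in the twisted space, with values in the tube. -/
def gTwistedBoundary (v : ℂ × ℂ) : GSph2 × GDisk2 :=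
  (gNormalize (gPolar (starRingEnd ℂ v.2) v.1), gCap v.2)

theorem continuousOn_gTwistedBoundary : ContinuousOn gTwistedBoundary (sphere 0 1) := by
  refine ContinuousOn.prodMk (continuousOn_gNormalize.comp (t := {p | p ≠ 0}) ?_ ?_)
    (continuous_gCap.comp continuous_snd).continuousOn
  · exact (continuous_gPolar.comp
      ((Complex.continuous_conj.comp continuous_snd).prodMk continuous_fst)).continuousOn
  · intro v hv
    refine gPolar_ne_zero ?_
    rcases (norm_eq_one_cases (mem_sphere_zero_iff_norm.1 hv)).2.2 with h | h
    · exact .inr h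
    · refine .inl (norm_ne_zero_iff.1 ?_)
      rw [Complex.norm_conj, h]
      exact one_ne_zero

section Core

variable {j : GSph2 × GDisk2 → GSph4}

theorem notMem_image_ball_of (hj : Function.Injective j) {p : GSph2 × GDisk2}
    (hp : p.1 = gSouth ∨ ‖(p.2 : ℂ)‖ = 1) :
    j p ∉ j '' {p : GSph2 × GDisk2 | p.1 ≠ gSouth ∧ ‖(p.2 : ℂ)‖ < 1} := by
  rw [hj.mem_set_image]
  rintro ⟨h1, h2⟩
  exact hp.elim h1 h2.ne

theorem notMem_image_ball (c : GluckCompl j) :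
    (c : GSph4) ∉ j '' {p : GSph2 × GDisk2 | p.1 ≠ gSouth ∧ ‖(p.2 : ℂ)‖ < 1} :=
  fun hc => c.2 (image_mono (fun _ hp => hp.2) hc)

theorem compactSpace_gluckCompl
    (hopen : IsOpen (j '' {p : GSph2 × GDisk2 | ‖(p.2 : ℂ)‖ < 1})) :
    CompactSpace (GluckCompl j) :=
  isCompact_iff_compactSpace.1 hopen.isClosed_compl.isCompact

theorem isOpen_image_ball (hj : IsEmbedding j)
    (hopen : IsOpen (j '' {p : GSph2 × GDisk2 | ‖(p.2 : ℂ)‖ < 1})) :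
    IsOpen (j '' {p : GSph2 × GDisk2 | p.1 ≠ gSouth ∧ ‖(p.2 : ℂ)‖ < 1}) := by
  obtain ⟨V, hV, hVj⟩ := hj.isOpen_iff.1
    ((isOpen_ne (x := gSouth)).preimage (continuous_fst (X := GSph2) (Y := GDisk2)))
  have : j '' {p : GSph2 × GDisk2 | p.1 ≠ gSouth ∧ ‖(p.2 : ℂ)‖ < 1} =
      j '' {p : GSph2 × GDisk2 | ‖(p.2 : ℂ)‖ < 1} ∩ V := by
    rw [← image_inter_preimage, hVj]
    congr 1
    ext p
    exact and_comm
  rw [this]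
  exact hopen.inter hV

theorem exists_lift_core (hj : Function.Injective j) {y : ℂ × ℂ → GSph4} {s : Set (ℂ × ℂ)}
    (hy : ContinuousOn y s)
    (hmem : ∀ v ∈ s, y v ∉ j '' {p : GSph2 × GDisk2 | p.1 ≠ gSouth ∧ ‖(p.2 : ℂ)‖ < 1}) :
    ∃ φ : ℂ × ℂ → GluckCore j, ContinuousOn φ s ∧ ∀ v ∈ s, (φ v : GSph4) = y v := by
  classical
  have hval : ∀ v ∈ s, ((if h : y v ∉ j '' {p : GSph2 × GDisk2 | p.1 ≠ gSouth ∧ ‖(p.2 : ℂ)‖ < 1}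
      then ⟨y v, h⟩ else ⟨j (gSouth, gCap 0), notMem_image_ball_of hj (.inl rfl)⟩ :
      GluckCore j) : GSph4) = y v := fun v hv => by rw [dif_pos (hmem v hv)]
  exact ⟨_, IsInducing.subtypeVal.continuousOn_iff.2 (hy.congr hval), hval⟩

theorem gCell_notMem_image_ball (hj : Function.Injective j) {v : ℂ × ℂ} (hv : ‖v‖ = 1) :
    j (gCell v) ∉ j '' {p : GSph2 × GDisk2 | p.1 ≠ gSouth ∧ ‖(p.2 : ℂ)‖ < 1} := by
  obtain ⟨-, h2, h | h⟩ := norm_eq_one_cases hv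
  · exact notMem_image_ball_of hj (.inl (gWrap_of_norm_eq_one h))
  · exact notMem_image_ball_of hj (.inr (by rw [gCell, gCap_val h2, h]))

theorem gTwistedBoundary_notMem_image_ball (hj : Function.Injective j) {v : ℂ × ℂ}
    (hv : ‖v‖ = 1) : j (gTwistedBoundary v) ∉
      j '' {p : GSph2 × GDisk2 | p.1 ≠ gSouth ∧ ‖(p.2 : ℂ)‖ < 1} := by
  obtain ⟨-, h2, h | h⟩ := norm_eq_one_cases hv
  · exact notMem_image_ball_of hj (.inl (gNormalize_gPolar_of_norm_eq_one _ h))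
  · exact notMem_image_ball_of hj (.inr (by rw [gTwistedBoundary, gCap_val h2, h]))

theorem exists_isCellAttachment_sphere (hj : IsEmbedding j)
    (hopen : IsOpen (j '' {p : GSph2 × GDisk2 | ‖(p.2 : ℂ)‖ < 1})) :
    ∃ φ : ℂ × ℂ → GluckCore j,
      IsCellAttachment φ (Subtype.val : GluckCore j → GSph4) (j ∘ gCell) := by
  have hcell := hj.continuous.comp continuous_gCell
  obtain ⟨φ, hφ, hφv⟩ := exists_lift_core hj.injective hcell.continuousOn (s := sphere 0 1)
    fun v hv => gCell_notMem_image_ball hj.injective (mem_sphere_zero_iff_norm.1 hv)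
  have : CompactSpace (GluckCore j) :=
    isCompact_iff_compactSpace.1 (isOpen_image_ball hj hopen).isClosed_compl.isCompact
  refine ⟨φ, hφ, .of_surjective_continuous ?_ ?_, ?_, Subtype.val_injective, ?_, ?_⟩
  · intro x
    by_cases hx : x ∈ j '' {p : GSph2 × GDisk2 | p.1 ≠ gSouth ∧ ‖(p.2 : ℂ)‖ < 1}
    · obtain ⟨p, -, rfl⟩ := hx
      obtain ⟨v, hv, rfl⟩ := exists_gCell_eq p
      exact ⟨.inr ⟨v, mem_closedBall_zero_iff.2 hv⟩, rfl⟩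
    · exact ⟨.inl ⟨x, hx⟩, rfl⟩
  · exact continuous_subtype_val.sumElim (hcell.comp continuous_subtype_val)
  · exact fun v hv => (hφv v (mem_sphere_zero_iff_norm.2 hv)).symm
  · exact hj.injective.comp_injOn gCell_injOn
  · intro v x hv h
    exact x.2 ⟨gCell v, gCell_mem hv, h⟩

theorem contractibleSpace_core (hj : IsEmbedding j)
    (hopen : IsOpen (j '' {p : GSph2 × GDisk2 | ‖(p.2 : ℂ)‖ < 1})) :
    ContractibleSpace (GluckCore j) := by
  obtain ⟨φ, h⟩ := exists_isCellAttachment_sphere hj hopen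
  have := contractibleSpace_sphere_compl_singleton ((j ∘ gCell) 0)
  exact h.contractibleSpace

end Core

section Twist

variable {j : GSph2 × GDisk2 → GSph4}

/-- The inclusion of the complement of the tube in the twisted space. -/
def GluckSpace.ofCompl (x : GluckCompl j) : GluckSpace j := Quot.mk _ (.inl x)

/-- The inclusion of the reglued tube in the twisted space. -/
def GluckSpace.ofTube (p : GSph2 × GDisk2) : GluckSpace j := Quot.mk _ (.inr p)

theorem GluckSpace.continuous_ofCompl : Continuous (ofCompl (j := j)) :=
  continuous_quot_mk.comp continuous_inl

theorem GluckSpace.continuous_ofTube : Continuous (ofTube (j := j)) :=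
  continuous_quot_mk.comp continuous_inr

theorem GluckSpace.ofCompl_eq_ofTube {c : GluckCompl j} {x : GSph2} {z : GDisk2}
    (hz : ‖(z : ℂ)‖ = 1) (hc : (c : GSph4) = j (x, z)) :
    ofCompl c = ofTube (j := j) (gRot z hz x, z) :=
  Quot.sound ⟨x, z, hz, hc, rfl⟩

open Classical in
/-- The set-theoretic identification of the twisted space with the 4-sphere, undoing the twist
on the boundary of the tube. -/
def GluckSpace.untwist : GluckSpace j → GSph4 :=
  Quot.lift (Sum.elim Subtype.val fun p => if h : ‖(p.2 : ℂ)‖ = 1 then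
      j (gRot (starRingEnd ℂ p.2) (by rwa [Complex.norm_conj]) p.1, p.2) else j p) <| by
    rintro (u | u) (v | v) ⟨x, z, hz, h1, h2⟩
    · exact h2.elim
    · subst h2
      simp only [Sum.elim_inl, Sum.elim_inr, h1, dif_pos hz]
      congr 2
      refine Subtype.ext (Prod.ext ?_ rfl)
      simp only [gRot]
      rw [← mul_assoc, Complex.conj_mul', hz]
      simp
    · exact h1.elim
    · exact h1.elim

theorem GluckSpace.untwist_ofCompl (x : GluckCompl j) : untwist (ofCompl x) = x := rfl

theorem GluckSpace.untwist_ofTube_of_ne {p : GSph2 × GDisk2} (hp : ‖(p.2 : ℂ)‖ ≠ 1) :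
    untwist (j := j) (ofTube p) = j p :=
  dif_neg hp

theorem GluckSpace.untwist_ofTube_gSouth (b : GDisk2) :
    untwist (j := j) (ofTube (gSouth, b)) = j (gSouth, b) := by
  by_cases hb : ‖(b : ℂ)‖ = 1
  · refine (dif_pos hb).trans ?_
    rw [gRot_gSouth]
  · exact untwist_ofTube_of_ne hb

theorem exists_core_map (hj : IsEmbedding j)
    (hopen : IsOpen (j '' {p : GSph2 × GDisk2 | ‖(p.2 : ℂ)‖ < 1})) :
    ∃ w : GluckCore j → GluckSpace j, Continuous w ∧ (∀ x, (w x).untwist = x) ∧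
      (∀ x : GluckCore j, ∀ c : GluckCompl j, (c : GSph4) = x → w x = .ofCompl c) ∧
      ∀ x : GluckCore j, ∀ b : GDisk2, (x : GSph4) = j (gSouth, b) →
        w x = .ofTube (gSouth, b) := by
  classical
  let w : GluckCore j → GluckSpace j := fun x =>
    if hx : (x : GSph4) ∉ j '' {p : GSph2 × GDisk2 | ‖(p.2 : ℂ)‖ < 1} then .ofCompl ⟨x, hx⟩
    else .ofTube (not_not.1 hx).choose
  have hwc : ∀ x : GluckCore j, ∀ c : GluckCompl j, (c : GSph4) = x → w x = .ofCompl c := by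
    rintro x ⟨c, hc⟩ rfl
    exact dif_pos hc
  have hws : ∀ x : GluckCore j, ∀ b : GDisk2, (x : GSph4) = j (gSouth, b) →
      w x = .ofTube (gSouth, b) := by
    intro x b hxb
    by_cases hb : ‖(b : ℂ)‖ < 1
    · have hx : (x : GSph4) ∈ j '' {p : GSph2 × GDisk2 | ‖(p.2 : ℂ)‖ < 1} := ⟨_, hb, hxb.symm⟩
      refine (dif_neg (not_not.2 hx)).trans (congrArg _ (hj.injective ?_))
      exact (not_not.1 (not_not.2 hx)).choose_spec.2.trans hxb
    · have hb1 : ‖(b : ℂ)‖ = 1 := (mem_closedBall_zero_iff.1 b.2).eq_of_not_lt hb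
      have hx : (x : GSph4) ∉ j '' {p : GSph2 × GDisk2 | ‖(p.2 : ℂ)‖ < 1} := by
        rwa [hxb, hj.injective.mem_set_image]
      rw [hwc x ⟨x, hx⟩ rfl, GluckSpace.ofCompl_eq_ofTube hb1 hxb, gRot_gSouth]
  have hcases : ∀ x : GluckCore j, (∃ c : GluckCompl j, (c : GSph4) = x) ∨
      ∃ b : GDisk2, (x : GSph4) = j (gSouth, b) := by
    intro x
    by_cases hx : (x : GSph4) ∈ j '' {p : GSph2 × GDisk2 | ‖(p.2 : ℂ)‖ < 1}
    · obtain ⟨⟨y, b⟩, hb, hyb⟩ := hx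
      have hy : y = gSouth := by
        by_contra hy
        exact x.2 ⟨(y, b), ⟨hy, hb⟩, hyb⟩
      exact .inr ⟨b, by rw [← hyb, hy]⟩
    · exact .inl ⟨⟨x, hx⟩, rfl⟩
  refine ⟨w, ?_, fun x => ?_, hwc, hws⟩
  · have := compactSpace_gluckCompl hopen
    let q : GluckCompl j ⊕ GDisk2 → GluckCore j := Sum.elim (fun c => ⟨c, notMem_image_ball c⟩)
      fun b => ⟨j (gSouth, b), notMem_image_ball_of hj.injective (.inl rfl)⟩
    have hjc := hj.continuous
    have hq : IsQuotientMap q := by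
      refine .of_surjective_continuous (fun x => ?_) (Continuous.sumElim ?_ ?_)
      · rcases hcases x with ⟨c, hc⟩ | ⟨b, hb⟩
        · exact ⟨.inl c, Subtype.ext hc⟩
        · exact ⟨.inr b, Subtype.ext hb.symm⟩
      · exact continuous_subtype_val.subtype_mk _
      · exact Continuous.subtype_mk (by fun_prop) _
    rw [hq.continuous_iff, continuous_sum_dom]
    exact ⟨GluckSpace.continuous_ofCompl.congr fun c => (hwc _ c rfl).symm,
      (GluckSpace.continuous_ofTube.comp (.prodMk_right gSouth)).congr
        fun b => (hws _ b rfl).symm⟩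
  · rcases hcases x with ⟨c, hc⟩ | ⟨b, hb⟩
    · rw [hwc x c hc, GluckSpace.untwist_ofCompl, hc]
    · rw [hws x b hb, GluckSpace.untwist_ofTube_gSouth, hb]

theorem exists_isCellAttachment_gluckSpace (hj : IsEmbedding j)
    (hopen : IsOpen (j '' {p : GSph2 × GDisk2 | ‖(p.2 : ℂ)‖ < 1})) :
    ∃ (φ : ℂ × ℂ → GluckCore j) (w : GluckCore j → GluckSpace j),
      IsCellAttachment φ w (GluckSpace.ofTube ∘ gCell) := by
  obtain ⟨w, hw, huw, hwc, hws⟩ := exists_core_map hj hopen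
  obtain ⟨φ, hφ, hφv⟩ := exists_lift_core hj.injective
    (hj.continuous.comp_continuousOn continuousOn_gTwistedBoundary)
    fun v hv => gTwistedBoundary_notMem_image_ball hj.injective (mem_sphere_zero_iff_norm.1 hv)
  have huntwist : ∀ v : ℂ × ℂ, ‖v‖ < 1 →
      GluckSpace.untwist (j := j) (.ofTube (gCell v)) = j (gCell v) := fun v hv =>
    GluckSpace.untwist_ofTube_of_ne (gCell_mem hv).2.ne
  refine ⟨φ, w, hφ, ?_, ?_, ?_, ?_, ?_⟩
  · have := compactSpace_gluckCompl hopen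
    have hcont : Continuous fun v : closedBall (0 : ℂ × ℂ) 1 => gCell v :=
      continuous_gCell.comp continuous_subtype_val
    have hq : IsQuotientMap (Sum.map id fun v : closedBall (0 : ℂ × ℂ) 1 => gCell v :
        GluckCompl j ⊕ closedBall (0 : ℂ × ℂ) 1 → GluckCompl j ⊕ GSph2 × GDisk2) := by
      refine .of_surjective_continuous (Function.Surjective.sumMap Function.surjective_id ?_)
        (continuous_id.sumMap hcont)
      intro p
      obtain ⟨v, hv, hvp⟩ := exists_gCell_eq p
      exact ⟨⟨v, mem_closedBall_zero_iff.2 hv⟩, hvp⟩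
    refine IsQuotientMap.of_comp
      (f := Sum.map (fun c : GluckCompl j => (⟨c, notMem_image_ball c⟩ : GluckCore j)) id)
      ((continuous_subtype_val.subtype_mk _).sumMap continuous_id)
      (hw.sumElim (GluckSpace.continuous_ofTube.comp hcont)) ?_
    have heq : (Sum.elim w fun v : closedBall (0 : ℂ × ℂ) 1 => GluckSpace.ofTube (gCell v)) ∘
        Sum.map (fun c : GluckCompl j => (⟨c, notMem_image_ball c⟩ : GluckCore j)) id =
        Quot.mk (gluckRel j) ∘ Sum.map id fun v : closedBall (0 : ℂ × ℂ) 1 => gCell v := by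
      funext x
      rcases x with c | v
      · exact hwc _ c rfl
      · rfl
    exact heq ▸ (isQuotientMap_quot_mk (r := gluckRel j)).comp hq
  · intro v hv
    have hφe := hφv v (mem_sphere_zero_iff_norm.2 hv)
    obtain ⟨-, h2, h | h⟩ := norm_eq_one_cases hv
    · rw [hws (φ v) (gCap v.2) (hφe.trans ?_)]
      · simp only [Function.comp, gCell, gWrap_of_norm_eq_one h]
      · simp only [Function.comp, gTwistedBoundary, gNormalize_gPolar_of_norm_eq_one _ h]
    · have hb : ‖(gCap v.2 : ℂ)‖ = 1 := by rw [gCap_val h2, h]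
      have hmem : (φ v : GSph4) ∉ j '' {p : GSph2 × GDisk2 | ‖(p.2 : ℂ)‖ < 1} := by
        rw [hφe, Function.comp, hj.injective.mem_set_image]
        exact hb.not_lt
      have hconj : starRingEnd ℂ v.2 ≠ 0 :=
        norm_ne_zero_iff.1 (by rw [Complex.norm_conj, h]; exact one_ne_zero)
      rw [hwc (φ v) ⟨φ v, hmem⟩ rfl, GluckSpace.ofCompl_eq_ofTube hb hφe,
        gRot_gNormalize_gPolar hb hconj, gCap_val h2, Complex.mul_conj', h]
      simp [gCell, gWrap]
  · exact fun x y h => Subtype.ext (by rw [← huw x, h, huw y])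
  · intro u hu v hv h
    refine gCell_injOn hu hv (hj.injective ?_)
    rw [← huntwist u (mem_ball_zero_iff.1 hu), ← huntwist v (mem_ball_zero_iff.1 hv)]
    exact congrArg _ h
  · intro v x hv h
    refine x.2 ⟨gCell v, gCell_mem hv, ?_⟩
    rw [← huw x, ← h, ← huntwist v hv]
    rfl

end Twist

end Gluck

theorem statement12 (j : GSph2 × GDisk2 → GSph4)
    (hj : Topology.IsEmbedding j)
    (hopen : IsOpen (j '' {p : GSph2 × GDisk2 | ‖(p.2 : ℂ)‖ < 1})) :
    SimplyConnectedSpace (GluckSpace j) ∧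
    Nonempty (ContinuousMap.HomotopyEquiv (GluckSpace j) GSph4) := by
  have := contractibleSpace_core hj hopen
  obtain ⟨φ, hS⟩ := exists_isCellAttachment_sphere hj hopen
  obtain ⟨φ', w, hX⟩ := exists_isCellAttachment_gluckSpace hj hopen
  obtain ⟨f⟩ := hX.nonempty_homotopyEquiv hS
  have : SimplyConnectedSpace GSph4 := simplyConnectedSpace_sphere (by simp)
  exact ⟨f.simplyConnectedSpace, ⟨f⟩⟩

end
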